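/- Let K be a convex body in ℝ² with o in the interior of K and |K|·|K*| ≤ (1+ε)·27/4 for some ε > 0. Let x ∈ ℝ², λ₁, λ₂ > 0, and let T be a triangle such that λ₁T + x ⊆ K ⊆ λ₂T + x and λ₂/λ₁ ≤ 1 + 900ε < 4. Assume further that the triangle [(λ₁+λ₂)/2]·T is an equilateral triangle of side length 1. Then the centroid of the triangle [(λ₁+λ₂)/2]·T + x is at Euclidean distance at most 917·√ε from the origin o. -/

import Mathlib

open MeasureTheory Pointwise Real
open scoped RealInnerProductSpace

/-- Area (two-dimensional Lebesgue measure) of a subset of the plane `ℂ ≅ ℝ²`. -/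
noncomputable def area (K : Set ℂ) : ℝ := (volume K).toReal

/-- The polar body `K* = {x : ⟨x,y⟩ ≤ 1 for all y ∈ K}`. -/
def polarBody (K : Set ℂ) : Set ℂ := {x | ∀ y ∈ K, ⟪x, y⟫ ≤ 1}

/-- A convex body: a compact convex set with nonempty interior. -/
def IsConvexBody (K : Set ℂ) : Prop := Convex ℝ K ∧ IsCompact K ∧ (interior K).Nonempty

/-- The planar cross product `p × q`. -/
def cross (p q : ℂ) : ℝ := p.re * q.im - p.im * q.re

theorem mem_convexHull_triple {a b c z : ℂ} : z ∈ convexHull ℝ {a, b, c} ↔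
    ∃ u v w : ℝ, 0 ≤ u ∧ 0 ≤ v ∧ 0 ≤ w ∧ u + v + w = 1 ∧ u • a + v • b + w • c = z := by
  constructor
  · rw [convexHull_insert (by simp), convexHull_pair, mem_convexJoin]
    rintro ⟨_, rfl, _, ⟨u, v, hu, hv, huv, rfl⟩, ⟨s, t, hs, ht, hst, rfl⟩⟩
    refine ⟨s, t * u, t * v, hs, by positivity, by positivity, ?_, ?_⟩
    · rw [add_assoc, ← mul_add, huv, mul_one, hst]
    · rw [smul_add, smul_smul, smul_smul, add_assoc]
  · rintro ⟨u, v, w, hu, hv, hw, h, rfl⟩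
    have hmem : ∀ y ∈ ({a, b, c} : Set ℂ), y ∈ convexHull ℝ {a, b, c} :=
      fun y hy => subset_convexHull ℝ _ hy
    have := (convex_convexHull ℝ {a, b, c}).sum_mem (t := Finset.univ) (w := ![u, v, w])
      (z := ![a, b, c]) (by simp [Fin.forall_fin_succ, *]) (by simp [Fin.sum_univ_three, h])
      (by intro i _; fin_cases i <;> exact hmem _ (by simp))
    simpa [Fin.sum_univ_three] using this

theorem volume_standard_triangle :
    volume {z : ℂ | 0 ≤ z.re ∧ 0 ≤ z.im ∧ z.re + z.im ≤ 1} = ENNReal.ofReal (1 / 2) := by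
  have hmeas : MeasurableSet {p : ℝ × ℝ | 0 ≤ p.1 ∧ 0 ≤ p.2 ∧ p.1 + p.2 ≤ 1} :=
    ((isClosed_le continuous_const continuous_fst).inter
      ((isClosed_le continuous_const continuous_snd).inter
        (isClosed_le (continuous_fst.add continuous_snd) continuous_const))).measurableSet
  have h := Complex.volume_preserving_equiv_real_prod.measure_preimage_emb
    Complex.measurableEquivRealProd.measurableEmbedding
    {p : ℝ × ℝ | 0 ≤ p.1 ∧ 0 ≤ p.2 ∧ p.1 + p.2 ≤ 1}
  have h2 : volume {p : ℝ × ℝ | 0 ≤ p.1 ∧ 0 ≤ p.2 ∧ p.1 + p.2 ≤ 1} = ENNReal.ofReal (1 / 2) := by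
    rw [Measure.volume_eq_prod, Measure.prod_apply hmeas]
    have hsec : ∀ x : ℝ, volume (Prod.mk x ⁻¹' {p : ℝ × ℝ | 0 ≤ p.1 ∧ 0 ≤ p.2 ∧ p.1 + p.2 ≤ 1})
        = (Set.Icc (0 : ℝ) 1).indicator (fun x => ENNReal.ofReal (1 - x)) x := by
      intro x
      by_cases hx : x ∈ Set.Icc (0 : ℝ) 1
      · rw [Set.indicator_of_mem hx]
        have : Prod.mk x ⁻¹' {p : ℝ × ℝ | 0 ≤ p.1 ∧ 0 ≤ p.2 ∧ p.1 + p.2 ≤ 1}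
            = Set.Icc 0 (1 - x) := by
          ext y
          simp only [Set.mem_preimage, Set.mem_ofPred_eq, Set.mem_Icc, hx.1, true_and]
          constructor <;> rintro ⟨h1, h2⟩ <;> constructor <;> linarith
        rw [this, Real.volume_Icc, sub_zero]
      · rw [Set.indicator_of_notMem hx]
        convert measure_empty (μ := volume)
        ext y
        simp only [Set.mem_preimage, Set.mem_ofPred_eq, Set.mem_empty_iff_false, iff_false]
        rintro ⟨h1, h2, h3⟩
        exact hx ⟨h1, by linarith⟩
    rw [lintegral_congr hsec, lintegral_indicator measurableSet_Icc,
      ← ofReal_integral_eq_lintegral_ofReal]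
    · rw [integral_Icc_eq_integral_Ioc, ← intervalIntegral.integral_of_le zero_le_one]
      congr 1
      rw [intervalIntegral.integral_sub (by simp) (by simp), integral_id]
      norm_num
    · exact (continuous_const.sub continuous_id).integrableOn_Icc
    · exact (ae_restrict_iff' measurableSet_Icc).2 (ae_of_all _ fun x hx => by simpa using hx.2)
  rw [← h2, ← h]
  rfl

theorem area_triangle (a b c : ℂ) :
    area (convexHull ℝ {a, b, c}) = |cross (a - c) (b - c)| / 2 := by
  let L : ℂ →ₗ[ℝ] ℂ :=
    Complex.reLm.smulRight (a - c) + Complex.imLm.smulRight (b - c)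
  have hL : ∀ z, L z = z.re • (a - c) + z.im • (b - c) := fun z => by simp [L]
  have hdet : LinearMap.det L = cross (a - c) (b - c) := by
    rw [← LinearMap.det_toMatrix Complex.basisOneI, Matrix.det_fin_two]
    simp [LinearMap.toMatrix_apply, hL, cross]
    ring
  have himg : convexHull ℝ {a, b, c} =
      c +ᵥ L '' {z : ℂ | 0 ≤ z.re ∧ 0 ≤ z.im ∧ z.re + z.im ≤ 1} := by
    ext z
    rw [mem_convexHull_triple, Set.mem_vadd_set]
    constructor
    · rintro ⟨u, v, w, hu, hv, hw, h, rfl⟩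
      refine ⟨_, ⟨⟨u, v⟩, ⟨hu, hv, by simp; linarith⟩, rfl⟩, ?_⟩
      obtain rfl : w = 1 - u - v := by linarith
      rw [hL, vadd_eq_add]
      module
    · rintro ⟨_, ⟨y, ⟨h1, h2, h3⟩, rfl⟩, rfl⟩
      refine ⟨y.re, y.im, 1 - y.re - y.im, h1, h2, by linarith, by ring, ?_⟩
      rw [hL, vadd_eq_add]
      module
  rw [area, himg, measure_vadd, Measure.addHaar_image_linearMap, volume_standard_triangle, hdet,
    ← ENNReal.ofReal_mul (abs_nonneg _), ENNReal.toReal_ofReal (by positivity)]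
  ring

theorem area_mono {s t : Set ℂ} (h : s ⊆ t) (ht : Bornology.IsBounded t) : area s ≤ area t :=
  ENNReal.toReal_mono ht.measure_lt_top.ne (measure_mono h)

theorem polarBody_anti {s t : Set ℂ} (h : s ⊆ t) : polarBody t ⊆ polarBody s :=
  fun _ hx y hy => hx y (h hy)

theorem convex_polarBody (s : Set ℂ) : Convex ℝ (polarBody s) := by
  intro x hx y hy p q hp hq hpq z hz
  rw [inner_add_left, real_inner_smul_left, real_inner_smul_left]
  nlinarith [hx z hz, hy z hz]

theorem mem_polarBody_convexHull {s : Set ℂ} {x : ℂ} (h : ∀ y ∈ s, ⟪x, y⟫ ≤ 1) :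
    x ∈ polarBody (convexHull ℝ s) := by
  have hc : Convex ℝ {y : ℂ | ⟪x, y⟫ ≤ 1} :=
    convex_halfSpace_le (innerₗ ℂ x).isLinear 1
  exact fun y hy => convexHull_min h hc hy

theorem isBounded_polarBody {s : Set ℂ} (h : (0 : ℂ) ∈ interior s) :
    Bornology.IsBounded (polarBody s) := by
  obtain ⟨r, hr, hb⟩ := Metric.mem_nhds_iff.1 (mem_interior_iff_mem_nhds.1 h)
  refine (Metric.isBounded_closedBall (x := (0 : ℂ)) (r := 2 / r)).subset fun x hx => ?_
  rw [mem_closedBall_zero_iff]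
  rcases eq_or_ne x 0 with rfl | hx0
  · simp; positivity
  have hn : 0 < ‖x‖ := norm_pos_iff.2 hx0
  have := hx ((r / 2 / ‖x‖) • x) (hb (by
    rw [mem_ball_zero_iff, norm_smul, Real.norm_of_nonneg (by positivity),
      div_mul_cancel₀ _ hn.ne']
    linarith))
  rw [real_inner_smul_right, real_inner_self_eq_norm_sq] at this
  rw [le_div_iff₀ hr]
  have e : r / 2 / ‖x‖ * ‖x‖ ^ 2 = r / 2 * ‖x‖ := by field_simp
  linarith

/-- The polar of a triangle with positive barycentric coordinates `t₁, t₂, t₃` of the origin has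
area at least `1 / (2 t₁ t₂ t₃ D)`, where `D` is twice the area of the triangle. -/
theorem le_area_polarBody_triangle {a b c : ℂ} {t₁ t₂ t₃ : ℝ} (h₁ : 0 < t₁) (h₂ : 0 < t₂)
    (h₃ : 0 < t₃) (ht : t₁ + t₂ + t₃ = 1) (h : t₁ • a + t₂ • b + t₃ • c = 0)
    (hD : cross (a - c) (b - c) ≠ 0)
    (hb : Bornology.IsBounded (polarBody (convexHull ℝ {a, b, c}))) :
    1 / (2 * (t₁ * t₂ * t₃) * |cross (a - c) (b - c)|) ≤
      area (polarBody (convexHull ℝ {a, b, c})) := by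
  set D := cross (a - c) (b - c) with hDdef
  obtain ⟨a1, a2⟩ := a
  obtain ⟨b1, b2⟩ := b
  obtain ⟨c1, c2⟩ := c
  have hre := congrArg Complex.re h
  have him := congrArg Complex.im h
  simp at hre him
  simp only [cross, Complex.sub_re, Complex.sub_im] at hDdef
  have d12 : a1 * b2 - a2 * b1 = t₃ * D := by
    obtain rfl : t₃ = 1 - t₁ - t₂ := by linarith
    rw [hDdef]
    linear_combination (b2 - a2) * hre + (a1 - b1) * him
  have d23 : b1 * c2 - b2 * c1 = t₁ * D := by
    obtain rfl : t₃ = 1 - t₁ - t₂ := by linarith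
    rw [hDdef]
    linear_combination (c2 - b2) * hre + (b1 - c1) * him
  have d31 : c1 * a2 - c2 * a1 = t₂ * D := by
    obtain rfl : t₃ = 1 - t₁ - t₂ := by linarith
    rw [hDdef]
    linear_combination (a2 - c2) * hre + (c1 - a1) * him
  have hinner : ∀ p q r s : ℝ, ⟪(⟨p, q⟩ : ℂ), ⟨r, s⟩⟫ = p * r + q * s := fun p q r s => by
    simp [Complex.inner, mul_comm]
  have hmem : ∀ w ∈ ({⟨-(b2 - c2) / (t₁ * D), (b1 - c1) / (t₁ * D)⟩,
      ⟨-(c2 - a2) / (t₂ * D), (c1 - a1) / (t₂ * D)⟩,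
      ⟨-(a2 - b2) / (t₃ * D), (a1 - b1) / (t₃ * D)⟩} : Set ℂ),
      w ∈ polarBody (convexHull ℝ {⟨a1, a2⟩, ⟨b1, b2⟩, ⟨c1, c2⟩}) := by
    intro w hw
    have hsum : t₁ * ⟪w, (⟨a1, a2⟩ : ℂ)⟫ + t₂ * ⟪w, (⟨b1, b2⟩ : ℂ)⟫ + t₃ * ⟪w, (⟨c1, c2⟩ : ℂ)⟫
        = 0 := by
      have := congrArg (inner ℝ w) h
      simpa only [inner_add_right, real_inner_smul_right, inner_zero_right] using this
    apply mem_polarBody_convexHull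
    simp only [Set.mem_insert_iff, Set.mem_singleton_iff] at hw
    have main : ⟪w, (⟨a1, a2⟩ : ℂ)⟫ ≤ 1 ∧ ⟪w, (⟨b1, b2⟩ : ℂ)⟫ ≤ 1 ∧ ⟪w, (⟨c1, c2⟩ : ℂ)⟫ ≤ 1 := by
      rcases hw with rfl | rfl | rfl
      · have e1 : ⟪(⟨-(b2 - c2) / (t₁ * D), (b1 - c1) / (t₁ * D)⟩ : ℂ), ⟨b1, b2⟩⟫ = 1 := by
          rw [hinner]; field_simp; linarith
        have e2 : ⟪(⟨-(b2 - c2) / (t₁ * D), (b1 - c1) / (t₁ * D)⟩ : ℂ), ⟨c1, c2⟩⟫ = 1 := by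
          rw [hinner]; field_simp; linarith
        rw [e1, e2] at hsum ⊢
        exact ⟨by nlinarith, le_rfl, le_rfl⟩
      · have e1 : ⟪(⟨-(c2 - a2) / (t₂ * D), (c1 - a1) / (t₂ * D)⟩ : ℂ), ⟨a1, a2⟩⟫ = 1 := by
          rw [hinner]; field_simp; linarith
        have e2 : ⟪(⟨-(c2 - a2) / (t₂ * D), (c1 - a1) / (t₂ * D)⟩ : ℂ), ⟨c1, c2⟩⟫ = 1 := by
          rw [hinner]; field_simp; linarith
        rw [e1, e2] at hsum ⊢
        exact ⟨le_rfl, by nlinarith, le_rfl⟩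
      · have e1 : ⟪(⟨-(a2 - b2) / (t₃ * D), (a1 - b1) / (t₃ * D)⟩ : ℂ), ⟨a1, a2⟩⟫ = 1 := by
          rw [hinner]; field_simp; linarith
        have e2 : ⟪(⟨-(a2 - b2) / (t₃ * D), (a1 - b1) / (t₃ * D)⟩ : ℂ), ⟨b1, b2⟩⟫ = 1 := by
          rw [hinner]; field_simp; linarith
        rw [e1, e2] at hsum ⊢
        exact ⟨le_rfl, le_rfl, by nlinarith⟩
    rintro y (rfl | rfl | rfl)
    exacts [main.1, main.2.1, main.2.2]
  refine le_trans (le_of_eq ?_) (area_mono (convexHull_min hmem (convex_polarBody _)) hb)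
  rw [area_triangle]
  have hcross : cross (⟨-(b2 - c2) / (t₁ * D), (b1 - c1) / (t₁ * D)⟩
        - ⟨-(a2 - b2) / (t₃ * D), (a1 - b1) / (t₃ * D)⟩)
      (⟨-(c2 - a2) / (t₂ * D), (c1 - a1) / (t₂ * D)⟩
        - ⟨-(a2 - b2) / (t₃ * D), (a1 - b1) / (t₃ * D)⟩) = 1 / (t₁ * t₂ * t₃ * D) := by
    simp only [cross, Complex.sub_re, Complex.sub_im]
    field_simp
    obtain rfl : t₃ = 1 - t₁ - t₂ := by linarith
    linear_combination -(1 - t₁ - t₂) * hDdef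
  rw [hcross, abs_div, abs_one, abs_mul, abs_of_pos (by positivity : 0 < t₁ * t₂ * t₃)]
  have : 0 < |D| := abs_pos.2 hD
  field_simp

theorem vadd_smul_convexHull_triple (x a b c : ℂ) (l : ℝ) :
    x +ᵥ l • convexHull ℝ {a, b, c} = convexHull ℝ {l • a + x, l • b + x, l • c + x} := by
  rw [← convexHull_smul, ← convexHull_vadd]
  simp only [Set.smul_set_insert, Set.smul_set_singleton, Set.vadd_set_insert,
    Set.vadd_set_singleton, vadd_eq_add, add_comm x]

theorem cross_smul_add_sub (x a b c : ℂ) (l : ℝ) :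
    cross ((l • a + x) - (l • c + x)) ((l • b + x) - (l • c + x)) =
      l ^ 2 * cross (a - c) (b - c) := by
  simp [cross]
  ring

theorem cross_ne_zero_of_equilateral {a b c : ℂ} {s : ℝ} (hs : 0 < s) (hab : dist a b = s)
    (hbc : dist b c = s) (hac : dist a c = s) : cross (a - c) (b - c) ≠ 0 := by
  have sq : ∀ z w : ℂ, dist z w = s → (z.re - w.re) ^ 2 + (z.im - w.im) ^ 2 = s ^ 2 := by
    rintro z w rfl
    rw [Complex.dist_eq, Complex.sq_norm, Complex.normSq_apply]
    simp
    ring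
  have h1 := sq _ _ hab
  have h2 := sq _ _ hbc
  have h3 := sq _ _ hac
  intro h
  simp only [cross, Complex.sub_re, Complex.sub_im] at h
  have hdot : (a.re - c.re) * (b.re - c.re) + (a.im - c.im) * (b.im - c.im) = s ^ 2 / 2 := by
    linarith
  have lag : ((a.re - c.re) * (b.im - c.im) - (a.im - c.im) * (b.re - c.re)) ^ 2
      + ((a.re - c.re) * (b.re - c.re) + (a.im - c.im) * (b.im - c.im)) ^ 2
      = ((a.re - c.re) ^ 2 + (a.im - c.im) ^ 2) * ((b.re - c.re) ^ 2 + (b.im - c.im) ^ 2) := by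
    ring
  rw [h, hdot, h3, h2] at lag
  have : 0 < s ^ 4 := by positivity
  nlinarith

/-- An interior point of a nondegenerate triangle has positive first barycentric coordinate. -/
theorem pos_of_barycentric_mem_interior {a b c z : ℂ} {u v w : ℝ}
    (hD : cross (a - c) (b - c) ≠ 0) (hz : z ∈ interior (convexHull ℝ {a, b, c}))
    (h : u + v + w = 1) (huvw : u • a + v • b + w • c = z) : 0 < u := by
  have hlim : Filter.Tendsto (fun η : ℝ => z - η • (a - c)) (nhdsWithin 0 (Set.Ioi 0)) (nhds z) := by
    have : Continuous fun η : ℝ => z - η • (a - c) := by fun_prop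
    simpa using (this.tendsto 0).mono_left nhdsWithin_le_nhds
  obtain ⟨η, hη, hpos⟩ := ((hlim.eventually (mem_interior_iff_mem_nhds.1 hz)).and
    self_mem_nhdsWithin).exists
  obtain ⟨u', v', w', hu', -, -, h', e⟩ := mem_convexHull_triple.1 hη
  have hcoord : ∀ p q r : ℝ, p + q + r = 1 →
      cross (p • a + q • b + r • c - c) (b - c) = p * cross (a - c) (b - c) := by
    intro p q r hpqr
    obtain rfl : r = 1 - p - q := by linarith
    simp [cross]
    ring
  have e1 := hcoord u v w h
  have e2 := hcoord u' v' w' h'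
  have e3 : cross (z - η • (a - c) - c) (b - c)
      = cross (z - c) (b - c) - η * cross (a - c) (b - c) := by
    simp [cross]
    ring
  rw [huvw] at e1
  rw [e, e3, e1, ← sub_mul] at e2
  have := mul_right_cancel₀ hD e2
  have hpos' : 0 < η := hpos
  linarith

theorem exists_pos_barycentric {a b c z : ℂ} (hD : cross (a - c) (b - c) ≠ 0)
    (hz : z ∈ interior (convexHull ℝ {a, b, c})) :
    ∃ u v w : ℝ, 0 < u ∧ 0 < v ∧ 0 < w ∧ u + v + w = 1 ∧ u • a + v • b + w • c = z := by
  obtain ⟨u, v, w, -, -, -, h, e⟩ := mem_convexHull_triple.1 (interior_subset hz)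
  have h1 : cross (b - a) (c - a) ≠ 0 := by
    convert hD using 1
    simp [cross]
    ring
  have h2 : cross (c - b) (a - b) ≠ 0 := by
    convert hD using 1
    simp [cross]
    ring
  refine ⟨u, v, w, pos_of_barycentric_mem_interior hD hz h e,
    pos_of_barycentric_mem_interior (z := z) h1 (u := v) (v := w) (w := u) ?_ (by linarith) ?_,
    pos_of_barycentric_mem_interior (z := z) h2 (u := w) (v := u) (w := v) ?_ (by linarith) ?_, h, e⟩
  · convert hz using 3
    ext y
    simp only [Set.mem_insert_iff, Set.mem_singleton_iff]
    tauto
  · rw [← e]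
    abel
  · convert hz using 3
    ext y
    simp only [Set.mem_insert_iff, Set.mem_singleton_iff]
    tauto
  · rw [← e]
    abel

/-- A nonempty closed set mapped into itself by a contracting homothety about the origin contains
the origin. -/
theorem zero_mem_of_smul_subset {s : Set ℂ} (hs : IsClosed s) (hne : s.Nonempty) {ρ : ℝ}
    (h0 : 0 ≤ ρ) (h1 : ρ < 1) (h : ρ • s ⊆ s) : (0 : ℂ) ∈ s := by
  obtain ⟨y, hy⟩ := hne
  have hpow : ∀ n : ℕ, ρ ^ n • y ∈ s := by
    intro n
    induction n with
    | zero => simpa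
    | succ k ih =>
      rw [pow_succ', mul_smul]
      exact h (Set.smul_mem_smul_set ih)
  have hlim : Filter.Tendsto (fun n : ℕ => ρ ^ n • y) Filter.atTop (nhds 0) := by
    simpa using (tendsto_pow_atTop_nhds_zero_of_lt_one h0 h1).smul_const y
  exact hs.mem_of_tendsto hlim (Filter.Eventually.of_forall hpow)

/-- Stability in the arithmetic–geometric mean inequality for three numbers of sum `1`. -/
theorem sum_sq_sub_third_le {p q r : ℝ} (hp : 0 < p) (hq : 0 < q) (hr : 0 < r)
    (h : p + q + r = 1) :
    (p - 1 / 3) ^ 2 + (q - 1 / 3) ^ 2 + (r - 1 / 3) ^ 2 ≤ 2 / 3 * (1 - 27 * (p * q * r)) := by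
  have h9 : 9 * (p * q * r) ≤ p * q + q * r + r * p := by
    have : p * q + q * r + r * p = (p + q + r) * (p * q + q * r + r * p) := by rw [h, one_mul]
    rw [this]
    nlinarith [mul_nonneg hp.le (sq_nonneg (q - r)), mul_nonneg hq.le (sq_nonneg (r - p)),
      mul_nonneg hr.le (sq_nonneg (p - q))]
  have h2 : (p + q + r) ^ 2 = 1 := by rw [h, one_pow]
  nlinarith

theorem norm_le_of_sum_sq_le {u v : ℂ} {s p q r κ ε : ℝ} (hε : 0 ≤ ε) (hκ : 0 ≤ κ)
    (hu : ‖u‖ ≤ s) (hv : ‖v‖ ≤ s) (hQ : p ^ 2 + q ^ 2 + r ^ 2 ≤ κ ^ 2 / 2 * ε) :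
    ‖p • u + q • v‖ ≤ s * (κ * √ε) := by
  have hs : 0 ≤ s := (norm_nonneg u).trans hu
  have h1 : |p| + |q| ≤ κ * √ε := by
    refine abs_le_of_sq_le_sq' ?_ (by positivity) |>.2
    rw [mul_pow, Real.sq_sqrt hε]
    nlinarith [sq_abs p, sq_abs q, sq_nonneg (|p| - |q|), sq_nonneg r]
  calc ‖p • u + q • v‖ ≤ |p| * ‖u‖ + |q| * ‖v‖ := by
        simpa [norm_smul] using norm_add_le (p • u) (q • v)
    _ ≤ |p| * s + |q| * s := by gcongr
    _ = s * (|p| + |q|) := by ring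
    _ ≤ s * (κ * √ε) := by gcongr

theorem one_sub_le_of_ratio {P ε l1 l2 : ℝ} (hε : 0 < ε) (hP : 0 < P) (hl1 : 0 < l1)
    (hratio : l2 ≤ (1 + 900 * ε) * l1) (hl2 : 0 < l2)
    (h : l1 ^ 2 / (4 * P * l2 ^ 2) ≤ (1 + ε) * (27 / 4)) : 1 - 27 * P ≤ 1801 * ε := by
  rw [div_le_iff₀ (by positivity)] at h
  have h2 : l2 ^ 2 ≤ (1 + 900 * ε) ^ 2 * l1 ^ 2 := by
    rw [← mul_pow]
    gcongr
  have h3 : 1 * l1 ^ 2 ≤ (27 * P * ((1 + ε) * (1 + 900 * ε) ^ 2)) * l1 ^ 2 := by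
    calc 1 * l1 ^ 2 ≤ 27 * P * (1 + ε) * l2 ^ 2 := by linarith
      _ ≤ 27 * P * (1 + ε) * ((1 + 900 * ε) ^ 2 * l1 ^ 2) := by gcongr
      _ = _ := by ring
  have h4 := le_of_mul_le_mul_right h3 (by positivity)
  by_contra! hlt
  have h5 : 27 * P * ((1 + ε) * (1 + 900 * ε) ^ 2)
      < (1 - 1801 * ε) * ((1 + ε) * (1 + 900 * ε) ^ 2) := by
    gcongr
    linarith
  have h6 : (1 - 1801 * ε) * ((1 + ε) * (1 + 900 * ε) ^ 2) ≤ 1 := by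
    have e2 : 0 < ε ^ 2 := by positivity
    have e3 : 0 < ε ^ 3 := by positivity
    have e4 : 0 < ε ^ 4 := by positivity
    nlinarith
  linarith

/-- Stability of the centre of polarity in the Mahler–Meyer inequality.
Here `T = [a,b,c]` is a triangle such that `[(λ₁+λ₂)/2]·T` is an equilateral
triangle of side length `1` (this is the paper's normalisation of the Euclidean
norm).  The centroid of `[(λ₁+λ₂)/2]·T + x` is `((λ₁+λ₂)/2)·((a+b+c)/3) + x`,
and it is at distance at most `917·√ε` from the origin. -/
theorem mahler_meyer_centre_stability (K : Set ℂ) (hK : IsConvexBody K)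
    (ho : (0 : ℂ) ∈ interior K) (ε : ℝ) (hε : 0 < ε)
    (hvp : area K * area (polarBody K) ≤ (1 + ε) * (27 / 4))
    (x a b c : ℂ) (l1 l2 : ℝ) (hl1 : 0 < l1) (hl2 : 0 < l2)
    (T : Set ℂ) (hT : T = convexHull ℝ {a, b, c})
    (hsub1 : x +ᵥ l1 • T ⊆ K) (hsub2 : K ⊆ x +ᵥ l2 • T)
    (hratio : l2 / l1 ≤ 1 + 900 * ε) (hsmall : 1 + 900 * ε < 4)
    (hside1 : dist (((l1 + l2) / 2 : ℝ) • a) (((l1 + l2) / 2 : ℝ) • b) = 1)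
    (hside2 : dist (((l1 + l2) / 2 : ℝ) • b) (((l1 + l2) / 2 : ℝ) • c) = 1)
    (hside3 : dist (((l1 + l2) / 2 : ℝ) • a) (((l1 + l2) / 2 : ℝ) • c) = 1) :
    ‖((l1 + l2) / 2 : ℝ) • ((a + b + c) / 3) + x‖ ≤ 917 * Real.sqrt ε := by
  have hm : 0 < (l1 + l2) / 2 := by positivity
  set s : ℝ := ((l1 + l2) / 2)⁻¹ with hs
  have hspos : 0 < s := by positivity
  have hms : (l1 + l2) * s = 2 := by rw [hs]; field_simp
  have hside : ∀ p q : ℂ, dist (((l1 + l2) / 2 : ℝ) • p) (((l1 + l2) / 2 : ℝ) • q) = 1 →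
      dist p q = s := by
    intro p q h
    rw [dist_smul₀, Real.norm_of_nonneg hm.le] at h
    exact eq_inv_of_mul_eq_one_right h
  have hab := hside _ _ hside1
  have hbc := hside _ _ hside2
  have hac := hside _ _ hside3
  have hD := cross_ne_zero_of_equilateral hspos hab hbc hac
  have hl : l2 ≤ (1 + 900 * ε) * l1 := (div_le_iff₀ hl1).1 hratio
  subst hT
  have hTclosed : IsClosed (convexHull ℝ {a, b, c}) :=
    (Set.toFinite _).isClosed_convexHull ℝ
  -- the homothetic triangles are nested
  have hl12 : l1 ≤ l2 := by
    have h := area_mono (hsub1.trans hsub2) (by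
      rw [vadd_smul_convexHull_triple]
      exact ((Set.toFinite _).isCompact_convexHull ℝ).isBounded)
    rw [vadd_smul_convexHull_triple, vadd_smul_convexHull_triple, area_triangle, area_triangle,
      cross_smul_add_sub, cross_smul_add_sub, abs_mul, abs_mul,
      abs_of_nonneg (sq_nonneg l1), abs_of_nonneg (sq_nonneg l2)] at h
    have hD' := abs_pos.2 hD
    exact le_of_sq_le_sq (le_of_mul_le_mul_right (by linarith) hD') hl2.le
  have hcentroid : (l2 - l1) * ‖(a + b + c) / 3‖ ≤ (l2 - l1) * s := by
    rcases hl12.eq_or_lt with rfl | hlt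
    · simp
    refine mul_le_mul_of_nonneg_left ?_ (by linarith)
    have h0 : (0 : ℂ) ∈ convexHull ℝ {a, b, c} := by
      refine zero_mem_of_smul_subset hTclosed ⟨a, subset_convexHull ℝ _ (by simp)⟩
        (ρ := l2⁻¹ * l1) (by positivity) ?_ ?_
      · rw [inv_mul_lt_iff₀ hl2]
        linarith
      · rw [mul_smul, Set.smul_set_subset_iff₀ (inv_ne_zero hl2.ne'), inv_inv]
        exact (Set.vadd_set_subset_vadd_set_iff).1 (hsub1.trans hsub2)
    have hball : convexHull ℝ {a, b, c} ⊆ Metric.closedBall ((a + b + c) / 3) s := by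
      refine convexHull_min ?_ (convex_closedBall _ _)
      have third : ∀ p q r : ℂ, dist p q = s → dist p r = s → dist p ((p + q + r) / 3) ≤ s := by
        intro p q r hq hr
        have e : p - (p + q + r) / 3 = (1 / 3 : ℝ) • (p - q) + (1 / 3 : ℝ) • (p - r) := by
          simp only [Complex.real_smul]
          push_cast
          ring
        rw [dist_eq_norm] at hq hr ⊢
        rw [e]
        refine (norm_add_le _ _).trans ?_
        rw [norm_smul, norm_smul, hq, hr]
        norm_num
        linarith
      rintro y (rfl | rfl | rfl)
      · exact third _ _ _ hab hac
      · rw [add_comm a]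
        exact third _ _ _ (dist_comm a y ▸ hab) hbc
      · rw [add_comm (a + b), ← add_assoc]
        exact third _ _ _ (dist_comm a y ▸ hac) (dist_comm b y ▸ hbc)
    simpa [dist_eq_norm] using hball h0
  -- barycentric coordinates of the origin
  set v₁ := l2 • a + x with hv₁
  set v₂ := l2 • b + x with hv₂
  set v₃ := l2 • c + x with hv₃
  have hcr : cross (v₁ - v₃) (v₂ - v₃) = l2 ^ 2 * cross (a - c) (b - c) :=
    cross_smul_add_sub x a b c l2
  have hD2 : cross (v₁ - v₃) (v₂ - v₃) ≠ 0 := by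
    rw [hcr]
    positivity
  rw [vadd_smul_convexHull_triple] at hsub1 hsub2
  have ho2 := interior_mono hsub2 ho
  obtain ⟨t₁, t₂, t₃, h₁, h₂, h₃, ht, h0⟩ := exists_pos_barycentric hD2 ho2
  have hpolar := (le_area_polarBody_triangle h₁ h₂ h₃ ht h0 hD2 (isBounded_polarBody ho2)).trans
    (area_mono (polarBody_anti hsub2) (isBounded_polarBody ho))
  have hbody := area_mono hsub1 hK.2.1.isBounded
  rw [area_triangle, cross_smul_add_sub, abs_mul,
    abs_of_nonneg (sq_nonneg l1)] at hbody
  rw [hcr, abs_mul, abs_of_nonneg (sq_nonneg l2)] at hpolar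
  have hD' := abs_pos.2 hD
  have hprod : l1 ^ 2 / (4 * (t₁ * t₂ * t₃) * l2 ^ 2) ≤ (1 + ε) * (27 / 4) := by
    refine le_trans (le_of_eq ?_)
      ((mul_le_mul hbody hpolar (by positivity) ENNReal.toReal_nonneg).trans hvp)
    field_simp
    norm_num
  have hdef := one_sub_le_of_ratio hε (by positivity) hl1 hl hl2 hprod
  have hQ := sum_sq_sub_third_le h₁ h₂ h₃ ht
  have hfirst : ‖l2 • ((a + b + c) / 3) + x‖ ≤ l2 * s * (50 * √ε) := by
    have e : l2 • ((a + b + c) / 3) + x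
        = (t₁ - 1 / 3) • (l2 • (c - a)) + (t₂ - 1 / 3) • (l2 • (c - b)) := by
      have : (l2 • ((a + b + c) / 3) + x : ℂ)
          = l2 • ((a + b + c) / 3) + x - (t₁ • v₁ + t₂ • v₂ + t₃ • v₃) := by rw [h0, sub_zero]
      rw [this, hv₁, hv₂, hv₃]
      obtain rfl : t₃ = 1 - t₁ - t₂ := by linarith
      simp only [Complex.real_smul]
      push_cast
      ring
    rw [e]
    refine norm_le_of_sum_sq_le (r := t₃ - 1 / 3) hε.le (by norm_num) ?_ ?_ (by linarith)
    · rw [norm_smul, Real.norm_of_nonneg hl2.le, ← dist_eq_norm, dist_comm, hac]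
    · rw [norm_smul, Real.norm_of_nonneg hl2.le, ← dist_eq_norm, dist_comm, hbc]
  have hl12s : l1 * s ≤ l2 * s := by gcongr
  have hl1s : 0 < l1 * s := by positivity
  have hl2s : l2 * s ≤ 2 := by linarith
  have hdiff : (l2 - l1) * s ≤ 900 * ε := by
    calc (l2 - l1) * s ≤ ((1 + 900 * ε) * l1 - l1) * s := by gcongr
      _ = 900 * ε * (l1 * s) := by ring
      _ ≤ 900 * ε * 1 := by
        gcongr
        linarith
      _ = 900 * ε := mul_one _
  have hε1 : ε ≤ √ε := by
    apply Real.le_sqrt_of_sq_le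
    rw [sq]
    exact mul_le_of_le_one_left hε.le (by linarith)
  have hsplit : ((l1 + l2) / 2 : ℝ) • ((a + b + c) / 3) + x
      = (l2 • ((a + b + c) / 3) + x) - ((l2 - l1) / 2) • ((a + b + c) / 3) := by
    module
  calc ‖((l1 + l2) / 2 : ℝ) • ((a + b + c) / 3) + x‖
      ≤ ‖l2 • ((a + b + c) / 3) + x‖ + ‖((l2 - l1) / 2) • ((a + b + c) / 3)‖ := by
        rw [hsplit]
        exact norm_sub_le _ _
    _ ≤ l2 * s * (50 * √ε) + (l2 - l1) * s / 2 := by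
        refine add_le_add hfirst ?_
        rw [norm_smul, Real.norm_of_nonneg (by linarith)]
        linarith
    _ ≤ 2 * (50 * √ε) + 900 * √ε / 2 := by
        refine add_le_add ?_ (by linarith)
        gcongr
    _ ≤ 917 * √ε := by linarith [Real.sqrt_nonneg ε]
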